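/- For all s,t ∈ ℕ and all n ≥ 1, the following two determinant identities hold: τ_n^{s,t+1}·τ_{n−1}^{s+1,t} = τ_n^{s,t}·τ_{n−1}^{s+1,t+1} − (ψ_{n−1}^{s,t})², and τ_n^{s,t+1}·ξ_{n−1}^{s,t} = τ_n^{s,t}·ξ_{n−1}^{s,t+1} − ψ_{n−1}^{s,t}·σ_{n−1}^{s,t}. -/

import Mathlib

open MeasureTheory

/-- Bimoments `m_{i,j}^{s,t}` of the Cauchy-Jacobi weight. -/
noncomputable def mom (s t i j : ℕ) : ℝ :=
  ∫ p in (Set.Ioo (0:ℝ) 1 ×ˢ Set.Ioo (0:ℝ) 1),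
    (p.1 ^ (s + i) * p.2 ^ (s + j) / (p.1 + p.2)) *
      ((1 - p.1) / (1 + p.1)) ^ t * ((1 - p.2) / (1 + p.2)) ^ t

/-- Single moments `φ_i^{s,t} = L_{s,t}(x^i)`. -/
noncomputable def phi (s t i : ℕ) : ℝ :=
  Real.sqrt 2 * ∫ x in Set.Ioo (0:ℝ) 1,
    (x ^ (s + i) / (1 + x)) * ((1 - x) / (1 + x)) ^ t

/-- Single moments `m_i^{s,t}`. -/
noncomputable def momS (s t i : ℕ) : ℝ :=
  ∫ x in Set.Ioo (0:ℝ) 1, x ^ (s + i) * ((1 - x) / (1 + x)) ^ t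

/-- `τ_n^{s,t} = det(m_{i,j}^{s,t})_{i,j=0}^{n-1}` (with `τ_0^{s,t} = 1`). -/
noncomputable def tau (s t n : ℕ) : ℝ :=
  Matrix.det (Matrix.of fun i j : Fin n => mom s t i j)

/-- `ξ_n^{s,t} = det(m_{i,j+1}^{s,t})_{i,j=0}^{n-1}` (with `ξ_0^{s,t} = 1`). -/
noncomputable def xi (s t n : ℕ) : ℝ :=
  Matrix.det (Matrix.of fun i j : Fin n => mom s t i ((j : ℕ) + 1))

/-- `σ_n^{s,t}`: determinant of the `(n+1)×(n+1)` matrix with first `n` columns the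
bimoments and last column `(φ_0^{s,t},…,φ_n^{s,t})`. -/
noncomputable def sig (s t n : ℕ) : ℝ :=
  Matrix.det (Matrix.of fun i j : Fin (n + 1) =>
    if (j : ℕ) < n then mom s t i j else phi s t i)

/-- `ψ_n^{s,t}`: like `σ_n^{s,t}` but with shifted bimoments `m_{i,j+1}^{s,t}`. -/
noncomputable def psi (s t n : ℕ) : ℝ :=
  Matrix.det (Matrix.of fun i j : Fin (n + 1) =>
    if (j : ℕ) < n then mom s t i ((j : ℕ) + 1) else phi s t i)

/-- `σ̃_n^{s,t}`: determinant of the `(n+1)×(n+1)` matrix with first `n` columns the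
bimoments and last column the single moments `(m_0^{s,t},…,m_n^{s,t})`. -/
noncomputable def sigT (s t n : ℕ) : ℝ :=
  Matrix.det (Matrix.of fun i j : Fin (n + 1) =>
    if (j : ℕ) < n then mom s t i j else momS s t i)

/-- `τ̃_n^{s,t}`: determinant of the `n×n` matrix whose rows are the bimoment rows
`i = 0,…,n−2,n`. -/
noncomputable def tauT (s t n : ℕ) : ℝ :=
  Matrix.det (Matrix.of fun i j : Fin n =>
    mom s t (if (i : ℕ) < n - 1 then (i : ℕ) else n) j)

/-- The monic Cauchy-Jacobi orthogonal polynomial `P_n^{s,t}` (as a real function). -/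
noncomputable def P (s t n : ℕ) (x : ℝ) : ℝ :=
  (1 / tau s t n) * Matrix.det (Matrix.of fun i j : Fin (n + 1) =>
    if (j : ℕ) < n then mom s t i j else x ^ (i : ℕ))

/-- The adjacent monic polynomial `Q_n^{s,t}` (as a real function). -/
noncomputable def Q (s t n : ℕ) (x : ℝ) : ℝ :=
  (1 / xi s t n) * Matrix.det (Matrix.of fun i j : Fin (n + 1) =>
    if (j : ℕ) < n then mom s t i ((j : ℕ) + 1) else x ^ (i : ℕ))

/-- The auxiliary monic polynomial `R_n^{s,t}` (as a real function): first column
`(φ_0,…,φ_n)`, next `n−1` columns the bimoments `m_{i,j}` for `j = 0,…,n−2`,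
last column `(1,x,…,x^n)`, normalized by `(−1)^{n−1}/σ_{n−1}^{s,t}`. -/
noncomputable def R (s t n : ℕ) (x : ℝ) : ℝ :=
  ((-1 : ℝ) ^ (n - 1) / sig s t (n - 1)) *
    Matrix.det (Matrix.of fun i j : Fin (n + 1) =>
      if (j : ℕ) = 0 then phi s t i
      else if (j : ℕ) < n then mom s t i ((j : ℕ) - 1) else x ^ (i : ℕ))

/-- The two-parameter deformed Cauchy inner product `⟨f,g⟩_{s,t}` on real functions. -/
noncomputable def innerF (s t : ℕ) (f g : ℝ → ℝ) : ℝ :=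
  ∫ p in (Set.Ioo (0:ℝ) 1 ×ˢ Set.Ioo (0:ℝ) 1),
    (p.1 ^ s * p.2 ^ s / (p.1 + p.2)) * f p.1 * g p.2 *
      ((1 - p.1) / (1 + p.1)) ^ t * ((1 - p.2) / (1 + p.2)) ^ t

/-- The two-parameter deformed Cauchy inner product on real polynomials. -/
noncomputable def innerP (s t : ℕ) (f g : Polynomial ℝ) : ℝ :=
  innerF s t (fun x => f.eval x) (fun y => g.eval y)

/-- The linear functional `L_{s,t}` on real functions. -/
noncomputable def LF (s t : ℕ) (f : ℝ → ℝ) : ℝ :=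
  Real.sqrt 2 * ∫ x in Set.Ioo (0:ℝ) 1,
    (x ^ s / (1 + x)) * f x * ((1 - x) / (1 + x)) ^ t

/-- The linear functional `L_{s,t}` on real polynomials. -/
noncomputable def LP (s t : ℕ) (f : Polynomial ℝ) : ℝ := LF s t (fun x => f.eval x)

section RankOneUpdate

variable {n R : Type*} [Fintype n] [DecidableEq n] [CommRing R]

namespace Matrix

open Polynomial

theorem det_sub_vecMulVec_of_isLeftRegular {A : Matrix n n R} (hA : IsLeftRegular A.det)
    (u v : n → R) :
    (A - vecMulVec u v).det = A.det - v ⬝ᵥ (A.adjugate *ᵥ u) := by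
  have hmul : fromBlocks A (replicateCol Unit u) (replicateRow Unit v) 1 *
      fromBlocks 1 (-replicateCol Unit (A.adjugate *ᵥ u)) 0 (A.det • 1) =
      fromBlocks A 0 (replicateRow Unit v)
        ((A.det - v ⬝ᵥ (A.adjugate *ᵥ u)) • (1 : Matrix Unit Unit R)) := by
    rw [fromBlocks_multiply]
    congr 1
    · simp
    · rw [replicateCol_mulVec, Matrix.mul_neg, ← Matrix.mul_assoc, mul_adjugate]
      simp
    · simp
    · ext
      simp [mul_apply, dotProduct]
      ring
  have h := congrArg det hmul
  rw [det_mul, det_fromBlocks_one₂₂, det_fromBlocks_zero₂₁, det_fromBlocks_zero₁₂,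
    ← vecMulVec_eq] at h
  simp only [det_one, one_mul, det_smul, Fintype.card_unit, pow_one, mul_one] at h
  exact hA (by simpa only [mul_comm] using h)

theorem det_smul_adjugate_sub_vecMulVec_of_isLeftRegular {A : Matrix n n R} {u v : n → R}
    (hA : IsLeftRegular A.det) (hB : IsLeftRegular (A - vecMulVec u v).det) :
    A.det • (A - vecMulVec u v).adjugate =
      (A - vecMulVec u v).det • A.adjugate +
        vecMulVec (A.adjugate *ᵥ u) (v ᵥ* A.adjugate) := by
  refine (isRegular_of_isLeftRegular_det hB).left ?_
  change (A - vecMulVec u v) * _ = (A - vecMulVec u v) * _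
  rw [Matrix.mul_smul, mul_adjugate, Matrix.mul_add, Matrix.mul_smul, Matrix.sub_mul,
    mul_adjugate, vecMulVec_mul, Matrix.sub_mul, mul_vecMulVec, vecMulVec_mul_vecMulVec,
    mulVec_mulVec, mul_adjugate, det_sub_vecMulVec_of_isLeftRegular hA]
  ext i j
  simp [vecMulVec_apply, smul_mulVec]
  ring

/-- The adjugate of a rank-one perturbation: a division-free Sherman–Morrison formula. -/
theorem det_smul_adjugate_sub_vecMulVec (A : Matrix n n R) (u v : n → R) :
    A.det • (A - vecMulVec u v).adjugate =
      (A - vecMulVec u v).det • A.adjugate +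
        vecMulVec (A.adjugate *ᵥ u) (v ᵥ* A.adjugate) := by
  let g : Matrix n n R → Matrix n n R[X] := fun M => M.map C + (X : R[X]) • 1
  let f : R[X] →+* R := evalRingHom 0
  have f_g : ∀ M, (g M).map f = M := fun M => by
    ext
    simp [f, g]
  have hreg : ∀ M : Matrix n n R, IsLeftRegular (g M).det := fun M => by
    refine (Polynomial.Monic.isRegular ?_).left
    simp only [g, Polynomial.Monic.def, ← Polynomial.leadingCoeff_det_X_one_add_C M, add_comm]
  have g_sub : g A - vecMulVec (C ∘ u) (C ∘ v) = g (A - vecMulVec u v) := by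
    ext1 i j
    simp [g, vecMulVec_apply]
    ring
  have h := det_smul_adjugate_sub_vecMulVec_of_isLeftRegular (u := C ∘ u) (v := C ∘ v)
    (hreg A) (by rw [g_sub]; exact hreg _)
  rw [g_sub] at h
  have f_det : ∀ M, f (g M).det = M.det := fun M => by
    rw [RingHom.map_det, RingHom.mapMatrix_apply, f_g]
  have f_adj : ∀ M i j, f ((g M).adjugate i j) = M.adjugate i j := fun M i j => by
    have := f.map_adjugate (g M)
    rw [RingHom.mapMatrix_apply, RingHom.mapMatrix_apply, f_g] at this
    exact congrFun₂ this i j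
  have f_C : ∀ r, f (C r) = r := fun r => by simp [f]
  ext i j
  have hij := congrArg f (congrFun₂ h i j)
  simpa [vecMulVec_apply, mulVec, vecMul, dotProduct, f_det, f_adj, f_C] using hij

end Matrix

end RankOneUpdate

section Moments

open Set

theorem integrableOn_mom (s t i j : ℕ) :
    IntegrableOn (fun p : ℝ × ℝ => (p.1 ^ (s + i) * p.2 ^ (s + j) / (p.1 + p.2)) *
      ((1 - p.1) / (1 + p.1)) ^ t * ((1 - p.2) / (1 + p.2)) ^ t)
      (Ioo (0:ℝ) 1 ×ˢ Ioo (0:ℝ) 1) := by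
  have hpow : IntegrableOn (fun x : ℝ => x ^ (-(1 / 2) : ℝ)) (Ioo 0 1) :=
    (intervalIntegral.integrableOn_Ioo_rpow_iff one_pos).2 (by norm_num)
  have hdom := Integrable.mul_prod hpow hpow
  rw [Measure.prod_restrict] at hdom
  refine hdom.mono' (Measurable.aestronglyMeasurable (by fun_prop)) ?_
  refine (ae_restrict_iff' (measurableSet_Ioo.prod measurableSet_Ioo)).2 (.of_forall ?_)
  rintro ⟨x, y⟩ ⟨⟨hx0, hx1⟩, hy0, hy1⟩
  dsimp only at hx0 hx1 hy0 hy1 ⊢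
  have ratio_nonneg : ∀ z : ℝ, 0 < z → z < 1 → 0 ≤ (1 - z) / (1 + z) := fun z h0 h1 =>
    div_nonneg (by linarith) (by linarith)
  have ratio_le_one : ∀ z : ℝ, 0 < z → (1 - z) / (1 + z) ≤ 1 := fun z h0 =>
    (div_le_one (by linarith)).2 (by linarith)
  have hwx := pow_le_one₀ (n := t) (ratio_nonneg x hx0 hx1) (ratio_le_one x hx0)
  have hwy := pow_le_one₀ (n := t) (ratio_nonneg y hy0 hy1) (ratio_le_one y hy0)
  have hwx0 := pow_nonneg (ratio_nonneg x hx0 hx1) t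
  have hwy0 := pow_nonneg (ratio_nonneg y hy0 hy1) t
  have hxp := pow_le_one₀ (n := s + i) hx0.le hx1.le
  have hyp := pow_le_one₀ (n := s + j) hy0.le hy1.le
  have hkernel : 1 / (x + y) ≤ x ^ (-(1 / 2) : ℝ) * y ^ (-(1 / 2) : ℝ) := by
    rw [Real.rpow_neg hx0.le, Real.rpow_neg hy0.le, ← Real.sqrt_eq_rpow, ← Real.sqrt_eq_rpow,
      ← mul_inv, ← one_div]
    refine one_div_le_one_div_of_le (by positivity) ?_
    nlinarith [Real.sq_sqrt hx0.le, Real.sq_sqrt hy0.le, sq_nonneg (√x - √y),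
      Real.sqrt_nonneg x, Real.sqrt_nonneg y]
  rw [Real.norm_of_nonneg (by positivity)]
  calc x ^ (s + i) * y ^ (s + j) / (x + y) * ((1 - x) / (1 + x)) ^ t * ((1 - y) / (1 + y)) ^ t
      ≤ 1 * 1 / (x + y) * 1 * 1 := by gcongr
    _ = 1 / (x + y) := by ring
    _ ≤ _ := hkernel

theorem mom_symm (s t i j : ℕ) : mom s t i j = mom s t j i := by
  unfold mom
  rw [Measure.volume_eq_prod, ← setIntegral_prod_swap]
  congr 1
  ext p
  simp only [Prod.fst_swap, Prod.snd_swap]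
  ring

theorem phi_mul_phi (s t i j : ℕ) :
    phi s t i * phi s t j = ∫ p in Ioo (0:ℝ) 1 ×ˢ Ioo (0:ℝ) 1,
      2 * ((p.1 ^ (s + i) / (1 + p.1) * ((1 - p.1) / (1 + p.1)) ^ t) *
        (p.2 ^ (s + j) / (1 + p.2) * ((1 - p.2) / (1 + p.2)) ^ t)) := by
  rw [integral_const_mul, Measure.volume_eq_prod,
    setIntegral_prod_mul (fun x : ℝ => x ^ (s + i) / (1 + x) * ((1 - x) / (1 + x)) ^ t)
      (fun y : ℝ => y ^ (s + j) / (1 + y) * ((1 - y) / (1 + y)) ^ t)]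
  unfold phi
  rw [mul_mul_mul_comm, Real.mul_self_sqrt zero_le_two]

theorem mom_succ (s t i j : ℕ) :
    mom s (t + 1) i j = mom s t i j - phi s t i * phi s t j := by
  have key : phi s t i * phi s t j = mom s t i j - mom s (t + 1) i j := by
    rw [phi_mul_phi]
    unfold mom
    rw [← integral_sub (integrableOn_mom s t i j) (integrableOn_mom s (t + 1) i j)]
    refine setIntegral_congr_fun (measurableSet_Ioo.prod measurableSet_Ioo) ?_
    rintro ⟨x, y⟩ ⟨⟨hx0, -⟩, hy0, -⟩
    dsimp only at hx0 hy0 ⊢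
    have hx : 1 + x ≠ 0 := by positivity
    have hy : 1 + y ≠ 0 := by positivity
    have hxy : x + y ≠ 0 := by positivity
    rw [pow_succ ((1 - x) / (1 + x)), pow_succ ((1 - y) / (1 + y))]
    generalize ((1 - x) / (1 + x)) ^ t = a
    generalize ((1 - y) / (1 + y)) ^ t = b
    field_simp
    ring
  linarith

theorem mom_succ_left (s t i j : ℕ) : mom (s + 1) t i j = mom s t (i + 1) (j + 1) := by
  simp only [mom, add_assoc, add_comm 1]

end Moments

section MomentMatrices

open Matrix

/-- The `n × n` matrix of bimoments, whose determinant is `tau s t n`. -/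
noncomputable def momMatrix (s t n : ℕ) : Matrix (Fin n) (Fin n) ℝ :=
  of fun i j => mom s t i j

/-- The vector of the first `n` single moments `phi s t i`. -/
noncomputable def phiVec (s t n : ℕ) : Fin n → ℝ :=
  fun i => phi s t i

variable (s t N : ℕ)

theorem momMatrix_isSymm (n : ℕ) : (momMatrix s t n).IsSymm := by
  ext i j
  exact mom_symm s t j i

theorem momMatrix_succ (n : ℕ) :
    momMatrix s (t + 1) n =
      momMatrix s t n - vecMulVec (phiVec s t n) (phiVec s t n) := by
  ext i j
  exact mom_succ s t i j

theorem adjugate_momMatrix_zero_zero :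
    (momMatrix s t (N + 1)).adjugate 0 0 = tau (s + 1) t N := by
  rw [adjugate_fin_succ_eq_det_submatrix]
  simp [tau, momMatrix, submatrix, mom_succ_left]

theorem adjugate_momMatrix_zero_last :
    (momMatrix s t (N + 1)).adjugate 0 (Fin.last N) = (-1) ^ N * xi s t N := by
  rw [adjugate_fin_succ_eq_det_submatrix]
  simp [xi, momMatrix, submatrix]

theorem adjugate_momMatrix_mulVec_phi_zero :
    ((momMatrix s t (N + 1)).adjugate *ᵥ phiVec s t (N + 1)) 0 = (-1) ^ N * psi s t N := by
  rw [← cramer_eq_adjugate_mulVec, cramer_apply]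
  have hpsi : psi s t N = (((momMatrix s t (N + 1)).updateCol 0
      (phiVec s t (N + 1))).submatrix id (finRotate (N + 1))).det := by
    unfold psi
    congr 1
    ext i j
    cases j using Fin.lastCases with
    | last => simp [phiVec]
    | cast j => simp [momMatrix]
  rw [hpsi, det_permute', sign_finRotate]
  simp [← mul_assoc, ← mul_pow]

theorem adjugate_momMatrix_mulVec_phi_last :
    ((momMatrix s t (N + 1)).adjugate *ᵥ phiVec s t (N + 1)) (Fin.last N) = sig s t N := by
  rw [← cramer_eq_adjugate_mulVec, cramer_apply]
  unfold sig
  congr 1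
  ext i j
  cases j using Fin.lastCases with
  | last => simp [phiVec]
  | cast j => simp [momMatrix]

theorem tau_mul_adjugate_momMatrix_succ (i j : Fin (N + 1)) :
    tau s t (N + 1) * (momMatrix s (t + 1) (N + 1)).adjugate i j =
      tau s (t + 1) (N + 1) * (momMatrix s t (N + 1)).adjugate i j +
        ((momMatrix s t (N + 1)).adjugate *ᵥ phiVec s t (N + 1)) i *
          ((momMatrix s t (N + 1)).adjugate *ᵥ phiVec s t (N + 1)) j := by
  have h := congrFun₂ (det_smul_adjugate_sub_vecMulVec (momMatrix s t (N + 1))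
    (phiVec s t (N + 1)) (phiVec s t (N + 1))) i j
  rw [← momMatrix_succ, ← mulVec_transpose, (momMatrix_isSymm s t (N + 1)).adjugate.eq] at h
  exact h

end MomentMatrices

/-- the two determinant identities
`τ_n^{s,t+1}τ_{n−1}^{s+1,t} = τ_n^{s,t}τ_{n−1}^{s+1,t+1} − (ψ_{n−1}^{s,t})²` and
`τ_n^{s,t+1}ξ_{n−1}^{s,t} = τ_n^{s,t}ξ_{n−1}^{s,t+1} − ψ_{n−1}^{s,t}σ_{n−1}^{s,t}`. -/
theorem bilinear_identities_IV (s t n : ℕ) (hn : 1 ≤ n) :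
    tau s (t + 1) n * tau (s + 1) t (n - 1) =
        tau s t n * tau (s + 1) (t + 1) (n - 1) - (psi s t (n - 1)) ^ 2 ∧
      tau s (t + 1) n * xi s t (n - 1) =
        tau s t n * xi s (t + 1) (n - 1) - psi s t (n - 1) * sig s t (n - 1) := by
  obtain ⟨N, rfl⟩ : ∃ N, n = N + 1 := ⟨n - 1, by omega⟩
  rw [Nat.add_sub_cancel]
  have h₁ := tau_mul_adjugate_momMatrix_succ s t N 0 0
  have h₂ := tau_mul_adjugate_momMatrix_succ s t N 0 (Fin.last N)
  simp only [adjugate_momMatrix_zero_zero, adjugate_momMatrix_zero_last,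
    adjugate_momMatrix_mulVec_phi_zero, adjugate_momMatrix_mulVec_phi_last] at h₁ h₂
  have hsq : ((-1 : ℝ) ^ N) * (-1) ^ N = 1 := by rw [← mul_pow]; simp
  refine ⟨?_, ?_⟩
  · linear_combination -h₁ - psi s t N ^ 2 * hsq
  · refine mul_left_cancel₀ (pow_ne_zero N (by norm_num : (-1 : ℝ) ≠ 0)) ?_
    linear_combination -h₂
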